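/- For the partially observable control model: (i) the sets S_I, S'_I, tilde-S_I, and tilde-S'_I are analytic; they are Borel if all constraint graphs Γ_n, n ≥ 0, are Borel; (ii) if ζ : P(𝕏) → P(Ω) is a universally measurable map with ζ(p_0) ∈ tilde-S_I(p_0) for all p_0 ∈ P(𝕏), then there exists a universally measurable policy π ∈ Π_I with ρ_{p_0}[π] = ζ(p_0) for all p_0; if in addition ζ(p_0) ∈ tilde-S'_I(p_0) for all p_0, then π can be taken nonrandomized. -/

import Mathlib

open MeasureTheory ProbabilityTheory Filter
open scoped ENNReal NNReal Topology

noncomputable section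

namespace PaperStmt

/-- The Borel σ-algebra of the topology of weak convergence on the space of Borel
probability measures. -/
instance instMeasProb {Ω : Type*} [MeasurableSpace Ω] [TopologicalSpace Ω]
    [OpensMeasurableSpace Ω] : MeasurableSpace (ProbabilityMeasure Ω) := borel _

/-- A set is universally measurable if it is measurable with respect to the completion of
every Borel probability measure. -/
def UniversallyMeasurableSet {α : Type*} [MeasurableSpace α] (s : Set α) : Prop :=
  ∀ μ : Measure α, IsProbabilityMeasure μ → NullMeasurableSet s μ

/-- A map between measurable spaces is universally measurable if preimages of measurable
sets are universally measurable. -/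
def UniversallyMeasurable {α β : Type*} [MeasurableSpace α] [MeasurableSpace β]
    (f : α → β) : Prop :=
  ∀ s : Set β, MeasurableSet s → UniversallyMeasurableSet (f ⁻¹' s)

/-- A function into the extended reals is lower semianalytic if all its sublevel sets are
analytic. -/
def LowerSemianalytic {γ : Type*} [TopologicalSpace γ] (f : γ → EReal) : Prop :=
  ∀ r : ℝ, MeasureTheory.AnalyticSet {x | f x ≤ (r : EReal)}

/-- The nonnegative part of an extended real number, as an element of `ℝ≥0∞`. -/
def ePos (y : EReal) : ℝ≥0∞ := if y = ⊤ then ⊤ else ENNReal.ofReal y.toReal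

/-- The integral `∫ f⁺ dμ - ∫ f⁻ dμ` of an extended-real-valued function, with the
convention `∞ - ∞ = ∞`. -/
def eint {γ : Type*} [MeasurableSpace γ] (μ : Measure γ) (f : γ → EReal) : EReal :=
  if (∫⁻ x, ePos (f x) ∂μ) = ⊤ then ⊤
  else ((∫⁻ x, ePos (f x) ∂μ : ℝ≥0∞) : EReal) - ((∫⁻ x, ePos (-f x) ∂μ : ℝ≥0∞) : EReal)

/-- Finite sums of extended reals, with the convention `∞ - ∞ = ∞`. -/
def esum {n : ℕ} (v : Fin n → EReal) : EReal :=
  if (∑ i, ePos (v i)) = ⊤ then ⊤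
  else ((∑ i, ePos (v i) : ℝ≥0∞) : EReal) - ((∑ i, ePos (-v i) : ℝ≥0∞) : EReal)

/-- The space `I_n = (ℤ × 𝔸)ⁿ × ℤ` of information vectors `i_n = (z_0,a_0,…,z_n)`. -/
abbrev Info (Z A : Type*) (n : ℕ) := (Fin n → Z × A) × Z

/-- The sample space `Ω = (𝕏 × ℤ × 𝔸)^∞` of the partially observable model. -/
abbrev TrajO (X Z A : Type*) := ℕ → X × Z × A

/-- Histories `(x_0, z_0, a_0, …, x_n)` of the partially observable model. -/
abbrev HistO (X Z A : Type*) (n : ℕ) := (Fin n → X × Z × A) × X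

/-- The information vector determined by a history, for the observation function `F`. -/
def infoOf {X Z A : Type*} (F : X → Z) : ∀ {n : ℕ}, HistO X Z A n → Info Z A n :=
  fun {_} h => (fun k => (h.1 k).2, F h.2)

/-- A universally measurable policy for the partially observable model: a sequence of
universally measurable stochastic kernels on `𝔸` given `I_n × P(𝕏)` respecting the
control constraints `U n`. -/
structure PolicyI (X : Type*) {Z A : Type*} [MeasurableSpace X] [TopologicalSpace X]
    [OpensMeasurableSpace X] [MeasurableSpace Z] [MeasurableSpace A]
    (U : ∀ n : ℕ, Info Z A n → Set A) where
  μ : ∀ n : ℕ, Info Z A n × ProbabilityMeasure X → Measure A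
  isProb : ∀ n ip, IsProbabilityMeasure (μ n ip)
  umeas : ∀ (n : ℕ) (B : Set A), MeasurableSet B →
    UniversallyMeasurable fun ip : Info Z A n × ProbabilityMeasure X => μ n ip B
  feasible : ∀ n i p0, μ n (i, p0) (U n i) = 1

/-- Nonrandomized policies of the partially observable model. -/
def PolicyI.Nonrandomized {X Z A : Type*} [MeasurableSpace X] [TopologicalSpace X]
    [OpensMeasurableSpace X] [MeasurableSpace Z] [MeasurableSpace A]
    {U : ∀ n : ℕ, Info Z A n → Set A} (π : PolicyI X U) : Prop :=
  ∀ n ip, ∃ a : A, π.μ n ip = Measure.dirac a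

variable {X Z A : Type*} [MeasurableSpace X] [TopologicalSpace X] [OpensMeasurableSpace X]
  [MeasurableSpace Z] [MeasurableSpace A]

/-- The iterated integral giving the finite-dimensional distributions of the partially
observable control model. -/
def histIntO (p0 : Measure X) (F : X → Z) (q : Kernel (X × A) X)
    (ν : ∀ n : ℕ, Info Z A n → Measure A) :
    ∀ n : ℕ, (HistO X Z A n → ℝ≥0∞) → ℝ≥0∞
  | 0, g => ∫⁻ x, g (Fin.elim0, x) ∂p0
  | n + 1, g => histIntO p0 F q ν n fun h =>
      ∫⁻ a, ∫⁻ y, g (Fin.snoc h.1 (h.2, F h.2, a), y) ∂(q (h.2, a)) ∂(ν n (infoOf F h))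

/-- `InducesI q F π p0 p` says that `p` is the strategic measure `ρ_{p0}[π]` of the
partially observable model with transition kernel `q` and observation function `F`. -/
def InducesI (q : Kernel (X × A) X) (F : X → Z) {U : ∀ n : ℕ, Info Z A n → Set A}
    (π : PolicyI X U) (p0 : ProbabilityMeasure X) (p : Measure (TrajO X Z A)) : Prop :=
  ∀ (n : ℕ) (B : Set (HistO X Z A n)), MeasurableSet B →
    p {ω : TrajO X Z A | ((fun i : Fin n => ω i.val), (ω n).1) ∈ B}
      = histIntO p0.toMeasure F q (fun n i => π.μ n (i, p0)) n (B.indicator fun _ => 1)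

/-- The set of strategic measures of the partially observable model induced by policies in
the class `C`. -/
def SIOf (q : Kernel (X × A) X) (F : X → Z) (U : ∀ n : ℕ, Info Z A n → Set A)
    (C : PolicyI X U → Prop) : Set (ProbabilityMeasure (TrajO X Z A)) :=
  {p | ∃ (π : PolicyI X U) (p0 : ProbabilityMeasure X), C π ∧ InducesI q F π p0 p.toMeasure}

/-- The section `tilde-S_I(p0)`. -/
def tsecI (q : Kernel (X × A) X) (F : X → Z) (U : ∀ n : ℕ, Info Z A n → Set A)
    (C : PolicyI X U → Prop) (p0 : ProbabilityMeasure X) :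
    Set (ProbabilityMeasure (TrajO X Z A)) :=
  {p | p ∈ SIOf q F U C ∧ p.toMeasure.map (fun ω => (ω 0).1) = p0.toMeasure}

/-- The set `tilde-S_I ⊂ P(𝕏) × P(Ω)`. -/
def tsetI (q : Kernel (X × A) X) (F : X → Z) (U : ∀ n : ℕ, Info Z A n → Set A)
    (C : PolicyI X U → Prop) :
    Set (ProbabilityMeasure X × ProbabilityMeasure (TrajO X Z A)) :=
  {pp | pp.2 ∈ tsecI q F U C pp.1}

end PaperStmt

namespace PaperStmt

section Analytic

/-- A neighbourhood of a box of `ℕ → ℕ` contains the set of sequences that satisfy finitely many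
of the bounds defining the box. -/
lemma exists_forall_lt_le_subset_of_isOpen {N : ℕ → ℕ} {O : Set (ℕ → ℕ)} (hO : IsOpen O)
    (hNO : {x | ∀ i, x i ≤ N i} ⊆ O) : ∃ m, {x : ℕ → ℕ | ∀ i < m, x i ≤ N i} ⊆ O := by
  by_contra! h
  simp only [Set.not_subset] at h
  choose x hx hxO using h
  have hK : IsCompact {x : ℕ → ℕ | ∀ i, x i ≤ N i} := by
    have := isCompact_univ_pi (X := fun _ : ℕ => ℕ) (s := fun i => Set.Iic (N i))
      fun i => (Set.finite_Iic (N i)).isCompact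
    convert this using 1
    ext x; simp [Pi.le_def]
  obtain ⟨y, -, φ, hφ, hlim⟩ := hK.tendsto_subseq (x := fun m i => min (x m i) (N i))
    (fun m i => min_le_right _ _)
  have hlim' : Tendsto (x ∘ φ) atTop (𝓝 y) := by
    rw [tendsto_pi_nhds] at hlim ⊢
    intro i
    refine (hlim i).congr' ?_
    filter_upwards [eventually_gt_atTop i] with m hm
    exact min_eq_left (hx (φ m) i (hm.trans_le (hφ.id_le m)))
  have hy : y ∈ Oᶜ := hO.isClosed_compl.mem_of_tendsto hlim' (Eventually.of_forall fun m => hxO _)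
  refine hy (hNO fun i => ?_)
  rw [tendsto_pi_nhds] at hlim
  exact le_of_tendsto (hlim i) (Eventually.of_forall fun m => min_le_right _ _)

/-- Analytic sets can be approximated from inside in (outer) measure by measurable sets. -/
lemma exists_measurableSet_subset_lt {α : Type*} [TopologicalSpace α] [T2Space α]
    [MeasurableSpace α] [OpensMeasurableSpace α] (μ : Measure α) [μ.OuterRegular]
    {s : Set α} (hs : AnalyticSet s) {t : ℝ≥0∞} (ht : t < μ s) :
    ∃ K ⊆ s, MeasurableSet K ∧ t ≤ μ K := by
  rw [AnalyticSet] at hs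
  obtain rfl | ⟨f, hf, rfl⟩ := hs
  · simp at ht
  have key : ∀ (S : {S : Set (ℕ → ℕ) // t < μ (f '' S)}) (k : ℕ),
      ∃ N : ℕ, t < μ (f '' (S.1 ∩ {x | x k ≤ N})) := by
    rintro ⟨S, hS⟩ k
    have hmono : Monotone fun N : ℕ => f '' (S ∩ {x | x k ≤ N}) := fun a b hab =>
      Set.image_mono (Set.inter_subset_inter_right _ fun x (hx : x k ≤ a) => hx.trans hab)
    have hU : ⋃ N : ℕ, f '' (S ∩ {x | x k ≤ N}) = f '' S := by
      rw [← Set.image_iUnion, ← Set.inter_iUnion]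
      congr 1
      ext x
      simp only [Set.mem_inter_iff, Set.mem_iUnion, and_iff_left_iff_imp]
      exact fun _ => ⟨x k, le_refl (x k)⟩
    rw [← hU, hmono.measure_iUnion] at hS
    exact lt_iSup_iff.1 hS
  choose B hB using key
  let S : ℕ → {S : Set (ℕ → ℕ) // t < μ (f '' S)} := fun k =>
    Nat.rec ⟨Set.univ, by simpa using ht⟩ (fun k S => ⟨_, hB S k⟩) k
  let N : ℕ → ℕ := fun k => B (S k) k
  have hS : ∀ k, (S k).1 = {x | ∀ i < k, x i ≤ N i} := by
    intro k
    induction k with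
    | zero => ext x; simp [S]
    | succ k ih =>
      have : (S (k + 1)).1 = (S k).1 ∩ {x | x k ≤ N k} := rfl
      rw [this, ih]
      ext x
      simp only [Set.mem_inter_iff, Set.mem_ofPred_eq, Nat.lt_succ_iff_lt_or_eq]
      constructor
      · rintro ⟨h1, h2⟩ i (hi | rfl)
        exacts [h1 i hi, h2]
      · exact fun h => ⟨fun i hi => h i (Or.inl hi), h k (Or.inr rfl)⟩
  have hK : IsCompact {x : ℕ → ℕ | ∀ i, x i ≤ N i} := by
    have := isCompact_univ_pi (X := fun _ : ℕ => ℕ) (s := fun i => Set.Iic (N i))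
      fun i => (Set.finite_Iic (N i)).isCompact
    convert this using 1
    ext x; simp [Pi.le_def]
  refine ⟨f '' {x | ∀ i, x i ≤ N i}, Set.image_subset_range _ _,
    (hK.image hf).isClosed.measurableSet, ?_⟩
  refine le_of_forall_gt fun r hr => ?_
  obtain ⟨W, hW, hWo, hWr⟩ := Set.exists_isOpen_lt_of_lt _ _ hr
  obtain ⟨m, hm⟩ := exists_forall_lt_le_subset_of_isOpen (hWo.preimage hf)
    (Set.image_subset_iff.1 hW)
  rw [← hS m] at hm
  exact ((S m).2.trans_le (measure_mono (Set.image_subset_iff.2 hm))).trans hWr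

theorem nullMeasurableSet_of_analyticSet {α : Type*} [TopologicalSpace α] [T2Space α]
    [MeasurableSpace α] [OpensMeasurableSpace α] (μ : Measure α) [IsFiniteMeasure μ]
    [μ.OuterRegular] {s : Set α} (hs : AnalyticSet s) : NullMeasurableSet s μ := by
  rcases eq_or_ne (μ s) 0 with h0 | h0
  · exact NullMeasurableSet.of_null h0
  obtain ⟨u, -, hu, hlim⟩ := exists_seq_strictMono_tendsto' (pos_iff_ne_zero.2 h0)
  choose K hKs hKm hKu using fun n => exists_measurableSet_subset_lt μ hs (hu n).2
  have hle : μ s ≤ μ (⋃ n, K n) :=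
    le_of_tendsto hlim (Eventually.of_forall fun n =>
      (hKu n).trans (measure_mono (Set.subset_iUnion K n)))
  have hsub : ⋃ n, K n ⊆ s := Set.iUnion_subset hKs
  have hm : MeasurableSet (⋃ n, K n) := MeasurableSet.iUnion hKm
  have hae : (⋃ n, K n : Set α) =ᵐ[μ] toMeasurable μ s :=
    ae_eq_of_subset_of_measure_ge (hsub.trans (subset_toMeasurable μ s))
      (by rwa [measure_toMeasurable]) hm.nullMeasurableSet (measure_ne_top _ _)
  refine hm.nullMeasurableSet.congr ?_
  refine (LE.le.eventuallyLE hsub).antisymm ?_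
  exact (LE.le.eventuallyLE (subset_toMeasurable μ s)).trans hae.symm.le

theorem universallyMeasurableSet_of_analyticSet {α : Type*} [TopologicalSpace α] [PolishSpace α]
    [MeasurableSpace α] [BorelSpace α] {s : Set α} (hs : AnalyticSet s) :
    UniversallyMeasurableSet s := fun μ _ => by
  let := TopologicalSpace.upgradeIsCompletelyMetrizable α
  exact nullMeasurableSet_of_analyticSet μ hs

end Analytic

section UnivMeas

/-- The σ-algebra of universally measurable sets. -/
@[reducible] def univMeas (α : Type*) [MeasurableSpace α] : MeasurableSpace α where
  MeasurableSet' s := UniversallyMeasurableSet s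
  measurableSet_empty := fun _ _ => nullMeasurableSet_empty
  measurableSet_compl := fun _ hs μ hμ => (hs μ hμ).compl
  measurableSet_iUnion := fun _ hs μ hμ => NullMeasurableSet.iUnion fun i => hs i μ hμ

variable {α β γ : Type*} [MeasurableSpace α] [MeasurableSpace β] [MeasurableSpace γ]

lemma le_univMeas : ‹MeasurableSpace α› ≤ univMeas α :=
  fun _ hs _ _ => hs.nullMeasurableSet

/-- A universally measurable map is measurable for the σ-algebras of universally measurable
sets. -/
theorem UniversallyMeasurable.preimage {f : α → β} (hf : UniversallyMeasurable f) {s : Set β}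
    (hs : UniversallyMeasurableSet s) : UniversallyMeasurableSet (f ⁻¹' s) := by
  intro μ hμ
  have hle : univMeas α ≤ μ.toOuterMeasure.caratheodory := fun t ht => by
    intro u
    exact (measure_inter_add_sdiff₀ u (ht μ hμ)).symm
  let μ' : @Measure α (univMeas α) := @OuterMeasure.toMeasure α (univMeas α) μ.toOuterMeasure hle
  have hμ' : ∀ t, UniversallyMeasurableSet t → μ' t = μ t := fun t ht =>
    @toMeasure_apply α (univMeas α) _ hle t ht
  have hfm : @Measurable α β (univMeas α) _ f := fun t ht => hf t ht
  let ν : Measure β := @Measure.map α β (univMeas α) _ f μ'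
  have hν : ∀ t, MeasurableSet t → ν t = μ (f ⁻¹' t) := fun t ht => by
    rw [← hμ' _ (hf t ht)]
    exact @Measure.map_apply α β (univMeas α) _ μ' f hfm t ht
  have : IsProbabilityMeasure ν := ⟨by rw [hν _ MeasurableSet.univ]; simp⟩
  obtain ⟨t, ht, hst⟩ := hs ν this
  have hN : ν {x | ¬ (x ∈ s ↔ x ∈ t)} = 0 := by
    have := hst.mem_iff
    rwa [ae_iff] at this
  refine (hf t ht μ hμ).congr ?_
  refine EventuallyEq.symm (eventuallyEq_set.2 ?_)
  rw [ae_iff]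
  refine measure_mono_null (t := f ⁻¹' toMeasurable ν {x | ¬ (x ∈ s ↔ x ∈ t)})
    (fun x hx => subset_toMeasurable ν _ hx) ?_
  rw [← hν _ (measurableSet_toMeasurable _ _), measure_toMeasurable, hN]

lemma Measurable.universallyMeasurable {f : α → β} (hf : Measurable f) :
    UniversallyMeasurable f := fun _ hs => le_univMeas _ (hf hs)

/-- A universally measurable map to a second countable Borel space is almost everywhere
measurable. -/
theorem UniversallyMeasurable.aemeasurable [TopologicalSpace β] [SecondCountableTopology β]
    [BorelSpace β] {f : α → β} (hf : UniversallyMeasurable f)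
    (μ : Measure α) [IsProbabilityMeasure μ] : AEMeasurable f μ := by
  let b := TopologicalSpace.countableBasis β
  have hb : Countable b := (TopologicalSpace.countable_countableBasis β).to_subtype
  have hbm : ∀ s : b, MeasurableSet s.1 := fun s =>
    (TopologicalSpace.isOpen_of_mem_countableBasis s.2).measurableSet
  choose t ht hst using fun s : b => hf s.1 (hbm s) μ inferInstance
  have hae : ∀ᵐ x ∂μ, ∀ s : b, (f x ∈ s.1 ↔ x ∈ t s) :=
    ae_all_iff.2 fun s => (hst s).mem_iff
  obtain ⟨N, hNsub, hN, hN0⟩ := exists_measurable_superset_of_null (ae_iff.1 hae)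
  by_cases hne : Nonempty β
  swap
  · have : IsEmpty β := not_nonempty_iff.1 hne
    have : IsEmpty α := Function.isEmpty f
    exact (measurable_of_empty f).aemeasurable
  obtain ⟨c⟩ := hne
  classical
  refine ⟨fun x => if x ∈ N then c else f x, ?_, ?_⟩
  · rw [BorelSpace.measurable_eq (α := β),
      (TopologicalSpace.isBasis_countableBasis β).borel_eq_generateFrom]
    refine measurable_generateFrom fun s hs => ?_
    have : (fun x => if x ∈ N then c else f x) ⁻¹' s
        = (N ∩ {_x | c ∈ s}) ∪ (t ⟨s, hs⟩ \ N) := by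
      ext x
      by_cases hx : x ∈ N
      · simp [hx]
      · have h1 : ∀ s : b, (f x ∈ s.1 ↔ x ∈ t s) := by
          by_contra hcon
          exact hx (hNsub hcon)
        simp [hx, ← h1 ⟨s, hs⟩]
    rw [this]
    exact (hN.inter (MeasurableSet.const _)).union ((ht _).diff hN)
  · rw [EventuallyEq, ae_iff]
    refine measure_mono_null (fun x hx => ?_) hN0
    by_contra hxN
    simp [hxN] at hx

end UnivMeas

section Selection

/-- Jankov–von Neumann selection for a continuous map defined on `ℕ → ℕ`. -/
theorem exists_universallyMeasurable_rightInverse {α : Type*} [TopologicalSpace α] [PolishSpace α]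
    [MeasurableSpace α] [BorelSpace α] {f : (ℕ → ℕ) → α} (hf : Continuous f) :
    ∃ s : α → ℕ → ℕ, UniversallyMeasurable s ∧ ∀ y ∈ Set.range f, f (s y) = y := by
  let r : (ℕ → ℕ) → ℕ → List ℕ := fun x k => (List.range k).map x
  have hr : ∀ x k, r x (k + 1) = r x k ++ [x k] := fun x k => by
    simp [r, List.range_succ]
  let C : List ℕ → Set α := fun l => f '' {x | r x l.length = l}
  have hC : ∀ l, MeasurableSet[univMeas α] (C l) := by
    intro l
    refine universallyMeasurableSet_of_analyticSet
      (MeasurableSet.analyticSet_image ?_ hf.measurable)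
    have : {x : ℕ → ℕ | r x l.length = l} = ⋂ i : Fin l.length, {x | x i = l[i]} := by
      ext x
      simp only [Set.mem_ofPred_eq, Set.mem_iInter, r]
      constructor
      · intro h i
        have := congrArg (fun l' => l'[i.1]?) h
        simpa using this
      · intro h
        refine List.ext_getElem (by simp) fun i h1 h2 => ?_
        simpa using h ⟨i, h2⟩
    rw [this]
    exact MeasurableSet.iInter fun i => measurable_pi_apply _ (measurableSet_singleton _)
  let nx : List ℕ → α → ℕ := fun l y => sInf {m | y ∈ C (l ++ [m])}
  have hnx : ∀ l m, MeasurableSet[univMeas α] {y | nx l y = m} := by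
    intro l m
    have : {y | nx l y = m} = (C (l ++ [m]) ∩ ⋂ j : Fin m, (C (l ++ [j.1]))ᶜ) ∪
        ({_y | m = 0} ∩ ⋂ j, (C (l ++ [j]))ᶜ) := by
      ext y
      simp only [Set.mem_ofPred_eq, Set.mem_union, Set.mem_inter_iff, Set.mem_iInter,
        Set.mem_compl_iff, nx]
      constructor
      · rintro rfl
        rcases Set.eq_empty_or_nonempty {m | y ∈ C (l ++ [m])} with h | h
        · right
          refine ⟨by rw [h]; simp, fun j hj => ?_⟩
          exact (Set.eq_empty_iff_forall_notMem.1 h) j hj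
        · left
          exact ⟨Nat.sInf_mem h, fun j hj => Nat.notMem_of_lt_sInf j.2 hj⟩
      · rintro (⟨h1, h2⟩ | ⟨rfl, h⟩)
        · refine le_antisymm (Nat.sInf_le h1) (le_csInf ⟨m, h1⟩ fun j hj => ?_)
          by_contra! hlt
          exact h2 ⟨j, hlt⟩ hj
        · have : {m | y ∈ C (l ++ [m])} = ∅ := Set.eq_empty_iff_forall_notMem.2 h
          rw [this, Nat.sInf_empty]
    rw [this]
    refine MeasurableSet.union (MeasurableSet.inter (hC _) (MeasurableSet.iInter fun j =>
      (hC _).compl)) (MeasurableSet.inter (MeasurableSet.const _) (MeasurableSet.iInter fun j =>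
      (hC _).compl))
  let p : α → ℕ → List ℕ := fun y k => Nat.rec [] (fun _ l => l ++ [nx l y]) k
  have hpS : ∀ y k, p y (k + 1) = p y k ++ [nx (p y k) y] := fun _ _ => rfl
  let s : α → ℕ → ℕ := fun y k => nx (p y k) y
  have hp : ∀ k l, MeasurableSet[univMeas α] {y | p y k = l} := by
    intro k
    induction k with
    | zero => exact fun l => MeasurableSet.const ([] = l)
    | succ k ih =>
      intro l
      have : {y | p y (k + 1) = l} =
          ⋃ (l' : List ℕ) (m : ℕ), ({y | p y k = l'} ∩ {y | nx l' y = m}) ∩ {_y | l' ++ [m] = l} := by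
        ext y
        simp only [Set.mem_ofPred_eq, Set.mem_iUnion, Set.mem_inter_iff, hpS]
        constructor
        · exact fun h => ⟨_, _, ⟨rfl, rfl⟩, h⟩
        · rintro ⟨l', m, ⟨rfl, rfl⟩, h⟩
          exact h
      rw [this]
      exact MeasurableSet.iUnion fun l' => MeasurableSet.iUnion fun m =>
        MeasurableSet.inter (MeasurableSet.inter (ih _) (hnx _ _)) (MeasurableSet.const _)
  have hsm : @Measurable α (ℕ → ℕ) (univMeas α) _ s := by
    refine @measurable_pi_lambda _ _ _ (univMeas α) _ _ fun k => ?_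
    refine @measurable_to_countable' _ _ _ _ (univMeas α) _ fun m => ?_
    have : (fun y => s y k) ⁻¹' {m} = ⋃ l : List ℕ, {y | p y k = l} ∩ {y | nx l y = m} := by
      ext y
      simp [s]
    rw [this]
    exact MeasurableSet.iUnion fun l => MeasurableSet.inter (hp _ _) (hnx _ _)
  refine ⟨s, fun t ht => hsm ht, fun y hy => ?_⟩
  have hinv : ∀ k, p y k = r (s y) k ∧ y ∈ C (p y k) := by
    intro k
    induction k with
    | zero =>
      obtain ⟨x, rfl⟩ := hy
      exact ⟨rfl, x, rfl, rfl⟩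
    | succ k ih =>
      refine ⟨by rw [hpS, hr, ← ih.1], ?_⟩
      obtain ⟨x, hx, hxy⟩ := ih.2
      have hne : {m | y ∈ C (p y k ++ [m])}.Nonempty := by
        refine ⟨x (p y k).length, x, ?_, hxy⟩
        have hx' : r x (p y k).length = p y k := hx
        simp only [Set.mem_ofPred_eq, List.length_append, List.length_singleton]
        rw [hr, hx']
      exact Nat.sInf_mem hne
  have hlen : ∀ k, (p y k).length = k := fun k => by rw [(hinv k).1]; simp [r]
  choose x hx hxy using fun k => (hinv k).2
  have hlim : Tendsto x atTop (𝓝 (s y)) := by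
    rw [tendsto_pi_nhds]
    intro i
    refine tendsto_const_nhds.congr' ?_
    filter_upwards [eventually_gt_atTop i] with k hk
    have h1 : r (x k) k = r (s y) k := by
      have : r (x k) (p y k).length = p y k := hx k
      rwa [hlen, (hinv k).1] at this
    have := congrArg (fun l' => l'[i]?) h1
    simpa [r, hk, eq_comm] using this
  refine tendsto_nhds_unique ((hf.tendsto _).comp hlim) ?_
  refine tendsto_const_nhds.congr fun k => (hxy k).symm

end Selection

section ProbabilityMeasureSpace

instance instBorelSpaceProbabilityMeasure {Y : Type*} [MeasurableSpace Y] [TopologicalSpace Y]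
    [OpensMeasurableSpace Y] : BorelSpace (ProbabilityMeasure Y) := ⟨rfl⟩

/-- The measure of a measurable set depends measurably on the probability measure. -/
theorem measurable_toMeasure_apply {Y : Type*} [TopologicalSpace Y] [HasOuterApproxClosed Y]
    [MeasurableSpace Y] [BorelSpace Y] {B : Set Y} (hB : MeasurableSet B) :
    Measurable fun μ : ProbabilityMeasure Y => μ.toMeasure B := by
  refine MeasurableSpace.induction_on_inter
    (C := fun B _ => Measurable fun μ : ProbabilityMeasure Y => μ.toMeasure B)
    (BorelSpace.measurable_eq.trans borel_eq_generateFrom_isClosed) isPiSystem_isClosed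
    ?_ ?_ ?_ ?_ B hB
  · simp
  · intro s hs
    refine ENNReal.measurable_of_tendsto (f := fun n μ => ∫⁻ x, hs.apprSeq n x ∂μ.toMeasure)
      (fun n => (ProbabilityMeasure.continuous_lintegral_boundedContinuousFunction
        (hs.apprSeq n)).measurable) ?_
    rw [tendsto_pi_nhds]
    exact fun μ => HasOuterApproxClosed.tendsto_lintegral_apprSeq hs μ.toMeasure
  · intro t ht ih
    simp_rw [prob_compl_eq_one_sub ht]
    exact measurable_const.sub ih
  · intro f hd hf ih
    simp_rw [measure_iUnion hd hf]
    exact Measurable.tsum ih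

lemma range_probabilityMeasure_map {Y K : Type*} [MeasurableSpace Y]
    [MeasurableSpace K] {j : Y → K}
    (hj : MeasurableEmbedding j) :
    Set.range (fun ν : ProbabilityMeasure Y => ν.map (f := j) hj.measurable.aemeasurable)
      = {ν | ν.toMeasure (Set.range j) = 1} := by
  ext ν
  constructor
  · rintro ⟨μ, rfl⟩
    rw [Set.mem_ofPred_eq, ProbabilityMeasure.map_apply' μ _ hj.measurableSet_range]
    simp
  · intro (h : ν.toMeasure (Set.range j) = 1)
    have hmap : (ν.toMeasure.comap j).map j = ν.toMeasure := by
      rw [hj.map_comap, Measure.restrict_eq_self_of_ae_mem]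
      exact (prob_compl_eq_zero_iff hj.measurableSet_range).2 h
    have : IsProbabilityMeasure (ν.toMeasure.comap j) := by
      refine ⟨?_⟩
      rw [hj.comap_apply, Set.image_univ, h]
    exact ⟨⟨ν.toMeasure.comap j, this⟩, Subtype.ext hmap⟩

variable {Y : Type*} [TopologicalSpace Y] [PolishSpace Y] [MeasurableSpace Y] [BorelSpace Y]

lemma measurable_toMeasure : Measurable fun μ : ProbabilityMeasure Y => μ.toMeasure := by
  let := TopologicalSpace.upgradeIsCompletelyMetrizable Y
  exact Measure.measurable_of_measurable_coe _ fun B hB => measurable_toMeasure_apply hB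

/-- The push-forward by a topological embedding is a topological embedding of spaces of
probability measures. -/
theorem isEmbedding_probabilityMeasure_map {K : Type*} [TopologicalSpace K]
    [TopologicalSpace.MetrizableSpace K] [MeasurableSpace K] [BorelSpace K]
    [SecondCountableTopology K] {j : Y → K} (hj : Topology.IsEmbedding j) :
    Topology.IsEmbedding fun ν : ProbabilityMeasure Y =>
      ν.map (f := j) hj.continuous.measurable.aemeasurable := by
  let := TopologicalSpace.upgradeIsCompletelyMetrizable Y
  let := TopologicalSpace.metrizableSpaceMetric K
  refine Topology.IsInducing.isEmbedding (Topology.isInducing_iff_nhds.2 fun μ => ?_)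
  refine le_antisymm
    (tendsto_iff_comap.1 (ProbabilityMeasure.continuous_map hj.continuous).continuousAt) ?_
  suffices h : Tendsto id (comap (fun ν : ProbabilityMeasure Y =>
      ν.map (f := j) hj.continuous.measurable.aemeasurable)
      (𝓝 (μ.map (f := j) hj.continuous.measurable.aemeasurable))) (𝓝 μ) from tendsto_id'.1 h
  refine tendsto_of_forall_isClosed_limsup_le' fun S hS => ?_
  obtain ⟨C, hC, rfl⟩ := hj.isClosed_iff.1 hS
  have key : ∀ ν : ProbabilityMeasure Y, ν.toMeasure (j ⁻¹' C)
      = (ν.map (f := j) hj.continuous.measurable.aemeasurable).toMeasure C := fun ν =>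
    (ProbabilityMeasure.map_apply' ν _ hC.measurableSet).symm
  simp only [id, key]
  exact ProbabilityMeasure.limsup_measure_closed_le_of_tendsto tendsto_comap hC

theorem exists_isEmbedding_probabilityMeasure (Y : Type*) [TopologicalSpace Y] [PolishSpace Y]
    [MeasurableSpace Y] [BorelSpace Y] : ∃ (K : Type) (_ : TopologicalSpace K)
    (_ : PolishSpace K) (_ : MeasurableSpace K) (_ : BorelSpace K) (f : ProbabilityMeasure Y → K),
    Topology.IsEmbedding f ∧ MeasurableSet (Set.range f) := by
  let := TopologicalSpace.upgradeIsCompletelyMetrizable Y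
  obtain ⟨j, hj⟩ := Metric.PiNatEmbed.exists_embedding_to_hilbert_cube (X := Y)
  have hjm : MeasurableEmbedding j := hj.continuous.measurableEmbedding hj.injective
  have : PolishSpace (ProbabilityMeasure (ℕ → unitInterval)) := by
    let := TopologicalSpace.metrizableSpaceMetric (ProbabilityMeasure (ℕ → unitInterval))
    infer_instance
  refine ⟨ProbabilityMeasure (ℕ → unitInterval), inferInstance, inferInstance, inferInstance,
    inferInstance, _, isEmbedding_probabilityMeasure_map hj, ?_⟩
  rw [range_probabilityMeasure_map hjm]
  exact measurable_toMeasure_apply hjm.measurableSet_range (measurableSet_singleton 1)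

lemma _root_.MeasurableEquiv.standardBorelSpace {α β : Type*} [MeasurableSpace α]
    [MeasurableSpace β] [StandardBorelSpace β] (e : α ≃ᵐ β) : StandardBorelSpace α := by
  let := upgradeStandardBorel β
  let : TopologicalSpace α := TopologicalSpace.induced e UpgradedStandardBorel.toTopologicalSpace
  refine ⟨⟨this, ⟨?_⟩, e.toEquiv.polishSpace_induced⟩⟩
  exact e.measurableEmbedding.comap_eq.symm.trans
    ((congrArg (MeasurableSpace.comap e) (eq_borel_upgradeStandardBorel β)).trans
      borel_comap.symm)

instance instSecondCountableTopologyProbabilityMeasure :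
    SecondCountableTopology (ProbabilityMeasure Y) := by
  obtain ⟨K, _, _, _, _, f, hf, -⟩ := exists_isEmbedding_probabilityMeasure Y
  exact hf.secondCountableTopology

instance instStandardBorelSpaceProbabilityMeasure :
    StandardBorelSpace (ProbabilityMeasure Y) := by
  obtain ⟨K, _, _, _, _, f, hf, hr⟩ := exists_isEmbedding_probabilityMeasure Y
  have := hr.standardBorel
  exact (hf.measurableEmbedding hr).equivRange.standardBorelSpace

/-- Maps into the space of probability measures are measurable if all evaluations are. -/
theorem measurable_probabilityMeasure_of_apply {α : Type*} [MeasurableSpace α]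
    {f : α → ProbabilityMeasure Y}
    (hf : ∀ B, MeasurableSet B → Measurable fun x => (f x).toMeasure B) : Measurable f := by
  let := TopologicalSpace.upgradeIsCompletelyMetrizable Y
  let S := generateSetAlgebra (TopologicalSpace.countableBasis Y)
  have hSc : Countable S :=
    (countable_generateSetAlgebra (TopologicalSpace.countable_countableBasis Y)).to_subtype
  have hgen : ‹MeasurableSpace Y› = MeasurableSpace.generateFrom S := by
    rw [generateFrom_generateSetAlgebra_eq, BorelSpace.measurable_eq (α := Y),
      (TopologicalSpace.isBasis_countableBasis Y).borel_eq_generateFrom]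
  have hSm : ∀ s : S, MeasurableSet s.1 := fun s => by
    rw [hgen]; exact MeasurableSpace.measurableSet_generateFrom s.2
  let e : ProbabilityMeasure Y → S → ℝ≥0∞ := fun μ s => μ.toMeasure s.1
  have he : MeasurableEmbedding e := by
    refine Measurable.measurableEmbedding
      (measurable_pi_lambda _ fun s => measurable_toMeasure_apply (hSm s)) fun μ ν h => ?_
    refine ProbabilityMeasure.toMeasure_injective (ext_of_generate_finite S hgen (fun s hs t ht _ =>
      isSetAlgebra_generateSetAlgebra.inter_mem hs ht)
      (fun s hs => congrFun h ⟨s, hs⟩) ?_)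
    rw [measure_univ, measure_univ]
  exact he.measurable_comp_iff.1 (measurable_pi_lambda _ fun s => hf _ (hSm s))

end ProbabilityMeasureSpace

section AnalyticMeasure

/-- The preimage of an analytic set under a measurable map is analytic. -/
theorem analyticSet_preimage_of_measurable {W Y : Type*} [TopologicalSpace W] [MeasurableSpace W]
    [OpensMeasurableSpace W] [SecondCountableTopology W] [StandardBorelSpace W]
    [TopologicalSpace Y] [MeasurableSpace Y] [BorelSpace Y] [MeasurableEq Y]
    {f : W → Y} (hf : Measurable f) {s : Set Y} (hs : AnalyticSet s) :
    AnalyticSet (f ⁻¹' s) := by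
  rw [AnalyticSet] at hs
  obtain rfl | ⟨g, hg, rfl⟩ := hs
  · exact analyticSet_empty
  have : f ⁻¹' Set.range g = Prod.fst '' {x : W × (ℕ → ℕ) | f x.1 = g x.2} := by
    ext w
    simp [eq_comm]
  rw [this]
  exact (measurableSet_eq_fun (hf.comp measurable_fst)
    (hg.measurable.comp measurable_snd)).analyticSet_image measurable_fst

lemma analyticSet_of_measurableSet {W : Type*} [TopologicalSpace W] [MeasurableSpace W]
    [OpensMeasurableSpace W] [SecondCountableTopology W] [StandardBorelSpace W]
    {s : Set W} (hs : MeasurableSet s) : AnalyticSet s := by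
  simpa using hs.analyticSet_image measurable_id

/-- The set of probability measures concentrated on an analytic set is analytic. -/
theorem analyticSet_measure_eq_one {Y : Type*} [TopologicalSpace Y] [PolishSpace Y]
    [MeasurableSpace Y] [BorelSpace Y] {s : Set Y} (hs : AnalyticSet s) :
    AnalyticSet {μ : ProbabilityMeasure Y | μ.toMeasure s = 1} := by
  have hs' := hs
  rw [AnalyticSet] at hs
  obtain rfl | ⟨g, hg, rfl⟩ := hs
  · simpa using analyticSet_empty
  obtain ⟨σ, hσ, hgσ⟩ := exists_universallyMeasurable_rightInverse hg
  have : {μ : ProbabilityMeasure Y | μ.toMeasure (Set.range g) = 1} =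
      (fun ν : ProbabilityMeasure (ℕ → ℕ) => ν.map (f := g) hg.measurable.aemeasurable) ''
        Set.univ := by
    rw [Set.image_univ]
    ext μ
    constructor
    · intro (h : μ.toMeasure (Set.range g) = 1)
      have hσm : AEMeasurable σ μ.toMeasure := hσ.aemeasurable _
      refine ⟨μ.map hσm, ProbabilityMeasure.toMeasure_injective ?_⟩
      have hae : ∀ᵐ y ∂μ.toMeasure, y ∈ Set.range g :=
        (prob_compl_eq_zero_iff₀ (universallyMeasurableSet_of_analyticSet hs' _ inferInstance)).2 h
      rw [ProbabilityMeasure.toMeasure_map, ProbabilityMeasure.toMeasure_map,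
        AEMeasurable.map_map_of_aemeasurable hg.measurable.aemeasurable hσm]
      conv_rhs => rw [← Measure.map_id (μ := μ.toMeasure)]
      exact Measure.map_congr (hae.mono fun y hy => hgσ y hy)
    · rintro ⟨ν, rfl⟩
      refine le_antisymm prob_le_one ?_
      rw [ProbabilityMeasure.toMeasure_map]
      refine le_trans ?_ (Measure.le_map_apply hg.measurable.aemeasurable _)
      simp
  rw [this]
  exact MeasurableSet.univ.analyticSet_image (ProbabilityMeasure.continuous_map hg).measurable

/-- Universally measurable selection from an analytic set with nonempty sections. -/
theorem exists_universallyMeasurable_selector {I A : Type*} [TopologicalSpace I] [PolishSpace I]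
    [MeasurableSpace I] [BorelSpace I] [TopologicalSpace A] [MeasurableSpace A] [BorelSpace A]
    {s : Set (I × A)} (hs : AnalyticSet s) (hne : ∀ i, ∃ a, (i, a) ∈ s) :
    ∃ φ : I → A, UniversallyMeasurable φ ∧ ∀ i, (i, φ i) ∈ s := by
  rw [AnalyticSet] at hs
  obtain rfl | ⟨g, hg, rfl⟩ := hs
  · have : IsEmpty I := ⟨fun i => by simpa using hne i⟩
    exact ⟨isEmptyElim, fun t _ => by
      rw [Set.eq_empty_of_isEmpty (_ ⁻¹' t)]
      exact @MeasurableSet.empty _ (univMeas I), isEmptyElim⟩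
  obtain ⟨σ, hσ, hgσ⟩ := exists_universallyMeasurable_rightInverse (continuous_fst.comp hg)
  refine ⟨fun i => (g (σ i)).2, fun t ht => ?_, fun i => ⟨σ i, ?_⟩⟩
  · exact hσ _ ((continuous_snd.comp hg).measurable ht)
  · obtain ⟨a, x, hx⟩ := hne i
    have : (g (σ i)).1 = i := hgσ i ⟨x, by simp [hx]⟩
    exact Prod.ext this rfl

/-- The measures under a kernel of the sections of a universally measurable set form a
universally measurable function. -/
theorem universallyMeasurable_kernel_section {V Y : Type*} [MeasurableSpace V] [MeasurableSpace Y]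
    (κ : Kernel V Y) [IsMarkovKernel κ] {s : Set (V × Y)} (hs : UniversallyMeasurableSet s) :
    UniversallyMeasurable fun x => κ x (Prod.mk x ⁻¹' s) := by
  intro t ht μ hμ
  obtain ⟨T, hT, hsT⟩ := hs (μ ⊗ₘ κ) inferInstance
  have h1 : ∀ᵐ x ∂μ, ∀ᵐ y ∂κ x, ((x, y) ∈ s ↔ (x, y) ∈ T) :=
    Measure.ae_ae_of_ae_compProd hsT.mem_iff
  have h2 : Measurable fun x => κ x (Prod.mk x ⁻¹' T) := Kernel.measurable_kernel_prodMk_left hT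
  refine (h2 ht).nullMeasurableSet.congr ?_
  refine eventuallyEq_set.2 ?_
  filter_upwards [h1] with x hx
  have : κ x (Prod.mk x ⁻¹' T) = κ x (Prod.mk x ⁻¹' s) :=
    measure_congr (eventuallyEq_set.2 (hx.mono fun y hy => hy.symm))
  simp [this]

end AnalyticMeasure

section History

variable {X Z A : Type*} {n : ℕ}

/-- Appending an observation, an action and a new state to a history. -/
def extendHist (F : X → Z) {n : ℕ} (x : HistO X Z A n × A × X) : HistO X Z A (n + 1) :=
  (Fin.snoc (α := fun _ => X × Z × A) x.1.1 (x.1.2, F x.1.2, x.2.1), x.2.2)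

/-- The information vector and the action at time `n`, as functions of the next history. -/
def infoAction (F : X → Z) (h : HistO X Z A (n + 1)) : Info Z A n × A :=
  ((fun k : Fin n => (h.1 k.castSucc).2, F (h.1 (Fin.last n)).1), (h.1 (Fin.last n)).2.2)

lemma infoAction_extendHist (F : X → Z) (x : HistO X Z A n × A × X) :
    infoAction F (extendHist F x) = (infoOf F x.1, x.2.1) := by
  simp only [infoAction, extendHist, infoOf, Fin.snoc_castSucc, Fin.snoc_last]

/-- The history at time `n` of a trajectory. -/
def histMap (n : ℕ) (ω : TrajO X Z A) : HistO X Z A n := (fun i => ω i, (ω n).1)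

end History

section Step

variable {X Z A : Type*} [MeasurableSpace X] [MeasurableSpace Z] [MeasurableSpace A] {n : ℕ}

lemma measurable_extendHist {F : X → Z} (hF : Measurable F) :
    Measurable (extendHist F : HistO X Z A n × A × X → HistO X Z A (n + 1)) := by
  refine Measurable.prodMk (measurable_pi_lambda _ fun i => ?_) (by fun_prop)
  refine Fin.lastCases ?_ (fun j => ?_) i
  · simp only [Fin.snoc_last]
    fun_prop
  · simp only [Fin.snoc_castSucc]
    fun_prop

lemma measurable_infoOf {F : X → Z} (hF : Measurable F) :
    Measurable (infoOf F : HistO X Z A n → Info Z A n) := by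
  unfold infoOf
  fun_prop

/-- The conditional distribution of the next action and the next state given a history, when
actions are chosen according to `ν`. -/
def stepKernel (q : Kernel (X × A) X) {F : X → Z} (hF : Measurable F)
    (ν : Kernel (Info Z A n) A) : Kernel (HistO X Z A n) (A × X) :=
  (ν.comap (infoOf F) (measurable_infoOf hF)) ⊗ₖ
    (q.comap (fun ha : HistO X Z A n × A => (ha.1.2, ha.2)) (by fun_prop))

instance (q : Kernel (X × A) X) [IsMarkovKernel q] {F : X → Z} (hF : Measurable F)
    (ν : Kernel (Info Z A n) A) [IsMarkovKernel ν] : IsMarkovKernel (stepKernel q hF ν) := by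
  unfold stepKernel
  infer_instance

/-- The distribution of the history at time `n + 1` when the history at time `n` has
distribution `M` and the action is chosen according to `ν`. -/
def stepMeasure (q : Kernel (X × A) X) {F : X → Z} (hF : Measurable F)
    (M : Measure (HistO X Z A n)) (ν : Kernel (Info Z A n) A) : Measure (HistO X Z A (n + 1)) :=
  (M ⊗ₘ stepKernel q hF ν).map (extendHist F)

lemma stepMeasure_congr (q : Kernel (X × A) X) [IsMarkovKernel q] {F : X → Z} (hF : Measurable F)
    {M : Measure (HistO X Z A n)} [IsProbabilityMeasure M] {ν ν' : Kernel (Info Z A n) A}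
    [IsMarkovKernel ν] [IsMarkovKernel ν'] (h : ν =ᵐ[M.map (infoOf F)] ν') :
    stepMeasure q hF M ν = stepMeasure q hF M ν' := by
  unfold stepMeasure
  congr 1
  refine Measure.compProd_congr ?_
  filter_upwards [ae_of_ae_map (measurable_infoOf hF).aemeasurable h] with x hx
  ext s hs
  simp only [stepKernel]
  rw [Kernel.compProd_apply hs, Kernel.compProd_apply hs]
  simp [Kernel.comap_apply, hx]

instance (q : Kernel (X × A) X) [IsMarkovKernel q] {F : X → Z} (hF : Measurable F)
    (M : Measure (HistO X Z A n)) [IsProbabilityMeasure M] (ν : Kernel (Info Z A n) A)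
    [IsMarkovKernel ν] : IsProbabilityMeasure (stepMeasure q hF M ν) :=
  Measure.isProbabilityMeasure_map (measurable_extendHist hF).aemeasurable

lemma measurable_infoAction {F : X → Z} (hF : Measurable F) :
    Measurable (infoAction F : HistO X Z A (n + 1) → Info Z A n × A) := by
  unfold infoAction
  fun_prop

/-- The joint distribution of the information vector and the action. -/
lemma map_infoAction_stepMeasure (q : Kernel (X × A) X) [IsMarkovKernel q] {F : X → Z}
    (hF : Measurable F) (M : Measure (HistO X Z A n)) [IsProbabilityMeasure M]
    (ν : Kernel (Info Z A n) A) [IsMarkovKernel ν] :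
    (stepMeasure q hF M ν).map (infoAction F) = (M.map (infoOf F)) ⊗ₘ ν := by
  have hi := measurable_infoOf (n := n) (A := A) hF
  ext s hs
  rw [stepMeasure, Measure.map_map (measurable_infoAction hF) (measurable_extendHist hF),
    Measure.map_apply ((measurable_infoAction hF).comp (measurable_extendHist hF)) hs,
    Measure.compProd_apply (((measurable_infoAction hF).comp (measurable_extendHist hF)) hs),
    Measure.compProd_apply hs, lintegral_map (Kernel.measurable_kernel_prodMk_left hs) hi]
  refine lintegral_congr fun h => ?_
  have h1 : Prod.mk h ⁻¹' (infoAction F ∘ extendHist F ⁻¹' s)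
      = Prod.fst ⁻¹' (Prod.mk (infoOf F h) ⁻¹' s) := by
    ext z
    simp [infoAction_extendHist]
  refine (congrArg _ h1).trans ((Kernel.fst_apply' _ _ (measurable_prodMk_left hs)).symm.trans ?_)
  rw [stepKernel, Kernel.fst_compProd, Kernel.comap_apply]

lemma histIntO_zero_eq_lintegral (p0 : Measure X) (F : X → Z)
    (q : Kernel (X × A) X)
    (νf : ∀ n : ℕ, Info Z A n → Measure A) {g : HistO X Z A 0 → ℝ≥0∞}
    (hg : AEMeasurable g (p0.map fun x => (Fin.elim0, x))) :
    histIntO p0 F q νf 0 g = ∫⁻ h, g h ∂(p0.map fun x => (Fin.elim0, x)) := by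
  rw [lintegral_map' hg (by fun_prop)]
  rfl

/-- The iterated integral of a policy is the integral with respect to the next history
distribution. -/
lemma histIntO_succ_eq_lintegral (p0 : Measure X) {F : X → Z} (hF : Measurable F)
    (q : Kernel (X × A) X) [IsMarkovKernel q] (νf : ∀ n : ℕ, Info Z A n → Measure A)
    {M : Measure (HistO X Z A n)} [IsProbabilityMeasure M]
    (hM : ∀ g, AEMeasurable g M → histIntO p0 F q νf n g = ∫⁻ h, g h ∂M)
    {ν : Kernel (Info Z A n) A} [IsMarkovKernel ν] (hν : νf n =ᵐ[M.map (infoOf F)] ν)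
    {g : HistO X Z A (n + 1) → ℝ≥0∞} (hg : AEMeasurable g (stepMeasure q hF M ν)) :
    histIntO p0 F q νf (n + 1) g = ∫⁻ h, g h ∂(stepMeasure q hF M ν) := by
  have hE := measurable_extendHist (n := n) (A := A) hF
  have hG : (fun h => ∫⁻ a, ∫⁻ y, g (extendHist F (h, a, y)) ∂(q (h.2, a)) ∂(νf n (infoOf F h)))
      =ᵐ[M] fun h => ∫⁻ z, hg.mk g (extendHist F (h, z)) ∂(stepKernel q hF ν h) := by
    have h1 := Measure.ae_ae_of_ae_compProd (ae_of_ae_map hE.aemeasurable hg.ae_eq_mk)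
    filter_upwards [h1, ae_of_ae_map (measurable_infoOf hF).aemeasurable hν] with h h1 h2
    rw [h2]
    have h3 := Kernel.ae_ae_of_ae_compProd h1
    have hm : Measurable fun z : A × X => hg.mk g (extendHist F (h, z)) :=
      hg.measurable_mk.comp (hE.comp measurable_prodMk_left)
    rw [stepKernel, Kernel.lintegral_compProd _ _ _ hm]
    refine lintegral_congr_ae ?_
    filter_upwards [h3] with a ha
    exact lintegral_congr_ae ha
  have hm : Measurable fun z => hg.mk g (extendHist F z) := hg.measurable_mk.comp hE
  have hGm : Measurable fun h => ∫⁻ z, hg.mk g (extendHist F (h, z)) ∂(stepKernel q hF ν h) :=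
    Measurable.lintegral_kernel_prod_right' hm
  refine (hM _ (hGm.aemeasurable.congr hG.symm)).trans ?_
  refine (lintegral_congr_ae hG).trans ?_
  refine Eq.trans ?_ (lintegral_congr_ae hg.ae_eq_mk.symm)
  rw [← Measure.lintegral_compProd hm, ← lintegral_map hg.measurable_mk hE]
  rfl

/-- A universally measurable family of probability measures agrees almost everywhere with a
Markov kernel. -/
lemma exists_kernel_ae_eq {I A : Type*} [MeasurableSpace I] [TopologicalSpace A] [PolishSpace A]
    [MeasurableSpace A] [BorelSpace A] {f : I → Measure A} (hf : ∀ i, IsProbabilityMeasure (f i))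
    (hfm : ∀ B, MeasurableSet B → UniversallyMeasurable fun i => f i B)
    (μ : Measure I) [IsProbabilityMeasure μ] :
    ∃ ν : Kernel I A, IsMarkovKernel ν ∧ f =ᵐ[μ] ν := by
  let f' : I → ProbabilityMeasure A := fun i => ⟨f i, hf i⟩
  have hf' : UniversallyMeasurable f' := fun s hs =>
    @measurable_probabilityMeasure_of_apply A _ _ _ _ I (univMeas I) f'
      (fun B hB t ht => hfm B hB t ht) s hs
  have hae := hf'.aemeasurable μ
  refine ⟨⟨fun i => (hae.mk f' i).toMeasure, measurable_toMeasure.comp hae.measurable_mk⟩,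
    ⟨fun i => (hae.mk f' i).2⟩, ?_⟩
  filter_upwards [hae.ae_eq_mk] with i hi
  exact congrArg ProbabilityMeasure.toMeasure hi

lemma measurable_histMap : Measurable (histMap n : TrajO X Z A → HistO X Z A n) := by
  unfold histMap
  fun_prop

end Step

section Induces

variable {X Z A : Type*} [TopologicalSpace X] [MeasurableSpace X] [OpensMeasurableSpace X]
  [MeasurableSpace Z] [TopologicalSpace A] [PolishSpace A] [MeasurableSpace A] [BorelSpace A]
  {q : Kernel (X × A) X} [IsMarkovKernel q] {F : X → Z} {U : ∀ n : ℕ, Info Z A n → Set A}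

theorem inducesI_of_stepMeasure (hF : Measurable F) (π : PolicyI X U) (p0 : ProbabilityMeasure X)
    (p : Measure (TrajO X Z A)) [IsProbabilityMeasure p]
    (h0 : p.map (histMap 0) = p0.toMeasure.map fun x => (Fin.elim0, x))
    (ν : ∀ n, Kernel (Info Z A n) A) [∀ n, IsMarkovKernel (ν n)]
    (hν : ∀ n, (fun i => π.μ n (i, p0)) =ᵐ[(p.map (histMap n)).map (infoOf F)] ν n)
    (hs : ∀ n, p.map (histMap (n + 1)) = stepMeasure q hF (p.map (histMap n)) (ν n)) :
    InducesI q F π p0 p := by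
  have hprob : ∀ n, IsProbabilityMeasure (p.map (histMap n)) := fun n =>
    Measure.isProbabilityMeasure_map measurable_histMap.aemeasurable
  have key : ∀ n, ∀ g, AEMeasurable g (p.map (histMap n)) →
      histIntO p0.toMeasure F q (fun n i => π.μ n (i, p0)) n g
        = ∫⁻ h, g h ∂(p.map (histMap n)) := by
    intro n
    induction n with
    | zero =>
      intro g hg
      rw [h0] at hg ⊢
      exact histIntO_zero_eq_lintegral _ _ _ _ hg
    | succ n ih =>
      intro g hg
      rw [hs] at hg ⊢
      exact histIntO_succ_eq_lintegral _ hF q (fun n i => π.μ n (i, p0)) ih (hν n) hg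
  intro n B hB
  rw [key n _ ((measurable_const.indicator hB).aemeasurable), lintegral_indicator hB]
  simp only [lintegral_const, MeasurableSet.univ, Measure.restrict_apply, Set.univ_inter, one_mul]
  rw [Measure.map_apply measurable_histMap hB]
  rfl

theorem InducesI.exists_stepMeasure {π : PolicyI X U} {p0 : ProbabilityMeasure X}
    {p : Measure (TrajO X Z A)} [IsProbabilityMeasure p] (h : InducesI q F π p0 p)
    (hF : Measurable F) :
    p.map (histMap 0) = p0.toMeasure.map (fun x => (Fin.elim0, x)) ∧
    ∀ n, ∃ ν : Kernel (Info Z A n) A, IsMarkovKernel ν ∧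
      (fun i => π.μ n (i, p0)) =ᵐ[(p.map (histMap n)).map (infoOf F)] ν ∧
      p.map (histMap (n + 1)) = stepMeasure q hF (p.map (histMap n)) ν := by
  have hprob : ∀ n, IsProbabilityMeasure (p.map (histMap n)) := fun n =>
    Measure.isProbabilityMeasure_map measurable_histMap.aemeasurable
  have h' : ∀ n (M : Measure (HistO X Z A n)),
      (∀ g, AEMeasurable g M → histIntO p0.toMeasure F q (fun n i => π.μ n (i, p0)) n g
        = ∫⁻ h, g h ∂M) → p.map (histMap n) = M := by
    intro n M hM
    ext B hB
    rw [Measure.map_apply measurable_histMap hB]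
    refine (h n B hB).trans ?_
    rw [hM _ ((measurable_const.indicator hB).aemeasurable), lintegral_indicator hB]
    simp
  have h0 := h' 0 _ fun g hg => histIntO_zero_eq_lintegral p0.toMeasure F q
    (fun n i => π.μ n (i, p0)) hg
  have hex : ∀ n, ∃ ν : Kernel (Info Z A n) A, IsMarkovKernel ν ∧
      (fun i => π.μ n (i, p0)) =ᵐ[(p.map (histMap n)).map (infoOf F)] ν := by
    intro n
    have : IsProbabilityMeasure ((p.map (histMap n)).map (infoOf F)) :=
      Measure.isProbabilityMeasure_map (measurable_infoOf hF).aemeasurable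
    refine exists_kernel_ae_eq (fun i => π.isProb n (i, p0)) (fun B hB t ht => ?_) _
    exact (Measurable.universallyMeasurable measurable_prodMk_right).preimage (π.umeas n B hB t ht)
  have key : ∀ n, ∀ g, AEMeasurable g (p.map (histMap n)) →
      histIntO p0.toMeasure F q (fun n i => π.μ n (i, p0)) n g
        = ∫⁻ h, g h ∂(p.map (histMap n)) := by
    intro n
    induction n with
    | zero =>
      intro g hg
      rw [h0] at hg ⊢
      exact histIntO_zero_eq_lintegral _ _ _ _ hg
    | succ n ih =>
      obtain ⟨ν, _, hν⟩ := hex n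
      have := fun g hg => histIntO_succ_eq_lintegral p0.toMeasure hF q
        (fun n i => π.μ n (i, p0)) ih hν (g := g) hg
      rw [h' _ _ this]
      exact this
  refine ⟨h0, fun n => ?_⟩
  obtain ⟨ν, hνm, hν⟩ := hex n
  refine ⟨ν, hνm, hν, h' _ _ fun g hg => ?_⟩
  exact histIntO_succ_eq_lintegral p0.toMeasure hF q (fun n i => π.μ n (i, p0)) (key n) hν hg

end Induces

lemma analyticSet_inter {W : Type*} [TopologicalSpace W] [T2Space W] {s t : Set W}
    (hs : AnalyticSet s) (ht : AnalyticSet t) : AnalyticSet (s ∩ t) := by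
  rw [Set.inter_eq_iInter]
  exact AnalyticSet.iInter fun b => by cases b <;> assumption

/-- A measure of composition-product form is concentrated on a set if and only if almost all
sections have full measure. -/
lemma compProd_eq_one_iff {I A : Type*} [MeasurableSpace I] [MeasurableSpace A] {μ : Measure I}
    [IsProbabilityMeasure μ] {ν : Kernel I A} [IsMarkovKernel ν] {s : Set (I × A)}
    (hs : NullMeasurableSet s (μ ⊗ₘ ν)) :
    (μ ⊗ₘ ν) s = 1 ↔ ∀ᵐ i ∂μ, ν i (Prod.mk i ⁻¹' s) = 1 := by
  obtain ⟨T, hT, hsT⟩ := hs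
  rw [measure_congr hsT, ← mem_ae_iff_prob_eq_one hT]
  refine (Measure.ae_compProd_iff hT).trans (eventually_congr ?_)
  filter_upwards [Measure.ae_ae_of_ae_compProd hsT] with i hi
  have h : (Prod.mk i ⁻¹' s : Set A) =ᵐ[ν i] Prod.mk i ⁻¹' T := hi
  rw [measure_congr h, ← mem_ae_iff_prob_eq_one (measurable_prodMk_left hT)]
  rfl

section Disintegration

variable {X Z A : Type*} [TopologicalSpace X] [PolishSpace X] [MeasurableSpace X] [BorelSpace X]
  [TopologicalSpace Z] [PolishSpace Z] [MeasurableSpace Z] [BorelSpace Z]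
  [TopologicalSpace A] [PolishSpace A] [MeasurableSpace A] [BorelSpace A]

/-- The evaluation kernel on the space of probability measures. -/
def evalKernel (Y : Type*) [TopologicalSpace Y] [PolishSpace Y] [MeasurableSpace Y]
    [BorelSpace Y] : Kernel (ProbabilityMeasure Y) Y :=
  ⟨fun p => p.toMeasure, measurable_toMeasure⟩

instance (Y : Type*) [TopologicalSpace Y] [PolishSpace Y] [MeasurableSpace Y] [BorelSpace Y] :
    IsMarkovKernel (evalKernel Y) := ⟨fun p => p.2⟩

/-- The joint distribution of information vector and action at time `n` under a probability
measure on the space of trajectories. -/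
def jointKernel (F : X → Z) (n : ℕ) :
    Kernel (ProbabilityMeasure (TrajO X Z A)) (Info Z A n × A) :=
  (evalKernel (TrajO X Z A)).map fun ω => infoAction F (histMap (n + 1) ω)

instance (F : X → Z) (n : ℕ) :
    IsFiniteKernel (jointKernel F n : Kernel (ProbabilityMeasure (TrajO X Z A)) _) := by
  unfold jointKernel
  infer_instance

lemma jointKernel_apply {F : X → Z} (hF : Measurable F) (n : ℕ)
    (p : ProbabilityMeasure (TrajO X Z A)) :
    jointKernel F n p = (p.toMeasure.map (histMap (n + 1))).map (infoAction F) := by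
  rw [Measure.map_map (measurable_infoAction hF) measurable_histMap, jointKernel,
    Kernel.map_apply (evalKernel (TrajO X Z A)) (f := fun ω => infoAction F (histMap (n + 1) ω))
      ((measurable_infoAction hF).comp measurable_histMap)]
  rfl

lemma map_fst_jointKernel {F : X → Z} (hF : Measurable F) (n : ℕ)
    (p : ProbabilityMeasure (TrajO X Z A)) :
    (jointKernel F n p).map Prod.fst = (p.toMeasure.map (histMap n)).map (infoOf F) := by
  rw [jointKernel_apply hF, Measure.map_map measurable_fst (measurable_infoAction hF),
    Measure.map_map (measurable_fst.comp (measurable_infoAction hF)) measurable_histMap,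
    Measure.map_map (measurable_infoOf hF) measurable_histMap]
  rfl

variable [Nonempty A]

/-- The conditional distribution of the action at time `n` given the information vector, jointly
measurable in the information vector and the probability measure on trajectories. -/
def actionKernel (F : X → Z) (n : ℕ) :
    Kernel (ProbabilityMeasure (TrajO X Z A) × Info Z A n) A :=
  (jointKernel F n).condKernel

instance (F : X → Z) (n : ℕ) : IsMarkovKernel
    (actionKernel F n : Kernel (ProbabilityMeasure (TrajO X Z A) × Info Z A n) A) := by
  unfold actionKernel
  infer_instance

lemma jointKernel_apply_eq_compProd {F : X → Z} (hF : Measurable F) (n : ℕ)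
    (p : ProbabilityMeasure (TrajO X Z A)) :
    jointKernel F n p
      = ((p.toMeasure.map (histMap n)).map (infoOf F)) ⊗ₘ ((actionKernel F n).sectR p) := by
  conv_lhs => rw [← (jointKernel F n).disintegrate (jointKernel F n).condKernel]
  rw [Kernel.compProd_apply_eq_compProd_sectR, Kernel.fst_apply, map_fst_jointKernel hF]
  rfl

/-- The conditional distribution of the action as a probability measure. -/
def actionProb (F : X → Z) (n : ℕ) (x : ProbabilityMeasure (TrajO X Z A) × Info Z A n) :
    ProbabilityMeasure A := ⟨actionKernel F n x, inferInstance⟩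

lemma measurable_actionProb (F : X → Z) (n : ℕ) : Measurable
    (actionProb F n : ProbabilityMeasure (TrajO X Z A) × Info Z A n → ProbabilityMeasure A) :=
  measurable_probabilityMeasure_of_apply fun _ hB => Kernel.measurable_coe _ hB

/-- The next history distribution obtained from `p` by following the conditional distribution of
the action under `p`. -/
def stepHistKernel (q : Kernel (X × A) X) {F : X → Z} (hF : Measurable F) (n : ℕ) :
    Kernel (ProbabilityMeasure (TrajO X Z A)) (HistO X Z A (n + 1)) :=
  (((evalKernel (TrajO X Z A)).map (histMap n)) ⊗ₖ
    (((actionKernel F n).comap (fun x : ProbabilityMeasure (TrajO X Z A) × HistO X Z A n =>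
        (x.1, infoOf F x.2)) (measurable_fst.prodMk ((measurable_infoOf hF).comp measurable_snd))) ⊗ₖ
      (q.comap (fun x : (ProbabilityMeasure (TrajO X Z A) × HistO X Z A n) × A =>
        (x.1.2.2, x.2)) (by fun_prop)))).map (extendHist F)

lemma stepHistKernel_apply (q : Kernel (X × A) X) [IsMarkovKernel q] {F : X → Z}
    (hF : Measurable F) (n : ℕ) (p : ProbabilityMeasure (TrajO X Z A)) :
    stepHistKernel q hF n p
      = stepMeasure q hF (p.toMeasure.map (histMap n)) ((actionKernel F n).sectR p) := by
  rw [stepHistKernel, Kernel.map_apply _ (measurable_extendHist hF),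
    Kernel.compProd_apply_eq_compProd_sectR, Kernel.map_apply _ measurable_histMap, stepMeasure]
  congr 2
  ext h s hs
  rw [Kernel.sectR_apply, stepKernel, Kernel.compProd_apply hs, Kernel.compProd_apply hs]
  rfl

/-- The probability measures on the space of trajectories that follow the transition kernel `q`,
respect the constraints, and for which the conditional distributions of actions belong
to `D`. -/
def IsConsistent (q : Kernel (X × A) X) {F : X → Z} (hF : Measurable F)
    (U : ∀ n : ℕ, Info Z A n → Set A) (D : Set (ProbabilityMeasure A))
    (p : ProbabilityMeasure (TrajO X Z A)) : Prop :=
  ∀ n, p.toMeasure.map (histMap (n + 1))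
      = stepMeasure q hF (p.toMeasure.map (histMap n)) ((actionKernel F n).sectR p) ∧
    jointKernel F n p {ia | ia.2 ∈ U n ia.1} = 1 ∧
    ∀ᵐ i ∂(p.toMeasure.map (histMap n)).map (infoOf F), actionProb F n (p, i) ∈ D

/-- The policies whose action distributions belong to `D`. -/
def ActsIn {U : ∀ n : ℕ, Info Z A n → Set A} (D : Set (ProbabilityMeasure A))
    (π : PolicyI X U) : Prop :=
  ∀ n ip, (⟨π.μ n ip, π.isProb n ip⟩ : ProbabilityMeasure A) ∈ D

variable {q : Kernel (X × A) X} [IsMarkovKernel q] {F : X → Z}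
  {U : ∀ n : ℕ, Info Z A n → Set A} {D : Set (ProbabilityMeasure A)}

instance (n : ℕ) (p : ProbabilityMeasure (TrajO X Z A)) :
    IsProbabilityMeasure (p.toMeasure.map (histMap n)) :=
  Measure.isProbabilityMeasure_map measurable_histMap.aemeasurable

theorem isConsistent_of_inducesI (hF : Measurable F)
    (hΓ : ∀ n : ℕ, AnalyticSet {ia : Info Z A n × A | ia.2 ∈ U n ia.1})
    {π : PolicyI X U} (hπ : ActsIn D π) {p0 : ProbabilityMeasure X}
    {p : ProbabilityMeasure (TrajO X Z A)} (h : InducesI q F π p0 p.toMeasure) :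
    IsConsistent q hF U D p := by
  intro n
  obtain ⟨ν, _, hν, hs⟩ := (h.exists_stepMeasure hF).2 n
  have : IsProbabilityMeasure ((p.toMeasure.map (histMap n)).map (infoOf F)) :=
    Measure.isProbabilityMeasure_map (measurable_infoOf hF).aemeasurable
  have hj : jointKernel F n p = ((p.toMeasure.map (histMap n)).map (infoOf F)) ⊗ₘ ν := by
    rw [jointKernel_apply hF, hs, map_infoAction_stepMeasure]
  have hae : (actionKernel F n).sectR p =ᵐ[(p.toMeasure.map (histMap n)).map (infoOf F)] ν :=
    Kernel.ae_eq_of_compProd_eq ((jointKernel_apply_eq_compProd hF n p).symm.trans hj)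
  refine ⟨hs.trans (stepMeasure_congr q hF hae.symm), ?_, ?_⟩
  · rw [hj, compProd_eq_one_iff (universallyMeasurableSet_of_analyticSet (hΓ n) _ inferInstance)]
    filter_upwards [hν] with i hi
    rw [← hi]
    exact π.feasible n i p0
  · filter_upwards [hν, hae] with i hi hi'
    have heq : actionProb F n (p, i) = ⟨π.μ n (i, p0), π.isProb n (i, p0)⟩ :=
      Subtype.ext (hi'.trans hi.symm)
    rw [heq]
    exact hπ n (i, p0)

theorem exists_policy (hF : Measurable F) (hne : ∀ n i, (U n i).Nonempty)
    (hΓ : ∀ n : ℕ, AnalyticSet {ia : Info Z A n × A | ia.2 ∈ U n ia.1})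
    (hD : MeasurableSet D) (hdirac : ∀ a : A, diracProba a ∈ D)
    {ζ : ProbabilityMeasure X → ProbabilityMeasure (TrajO X Z A)} (hζ : UniversallyMeasurable ζ) :
    ∃ π : PolicyI X U, ActsIn D π ∧ ∀ p0, IsConsistent q hF U D (ζ p0) →
      (ζ p0).toMeasure.map (fun ω => (ω 0).1) = p0.toMeasure →
      InducesI q F π p0 (ζ p0).toMeasure := by
  classical
  choose φ hφ hφU using fun n => exists_universallyMeasurable_selector (hΓ n) (hne n)
  let g : ∀ n, Info Z A n × ProbabilityMeasure X →
      ProbabilityMeasure (TrajO X Z A) × Info Z A n := fun n ip => (ζ ip.2, ip.1)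
  have hg : ∀ n, UniversallyMeasurable (g n) := by
    intro n
    have h1 : @Measurable _ _ (univMeas (Info Z A n × ProbabilityMeasure X)) _ fun ip => ζ ip.2 :=
      fun s hs => (Measurable.universallyMeasurable measurable_snd).preimage (hζ s hs)
    have h2 : @Measurable _ _ (univMeas (Info Z A n × ProbabilityMeasure X)) _
        (Prod.fst : Info Z A n × ProbabilityMeasure X → _) :=
      fun s hs => Measurable.universallyMeasurable measurable_fst s hs
    intro s hs
    exact @Measurable.prodMk (Info Z A n × ProbabilityMeasure X) _ _ _ _ _
      (fun ip => ζ ip.2) Prod.fst h1 h2 s hs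
  let c : ∀ n, Info Z A n × ProbabilityMeasure X → Prop := fun n ip =>
    actionKernel F n (g n ip) (U n ip.1) = 1 ∧ actionProb F n (g n ip) ∈ D
  have hc : ∀ n, MeasurableSet[univMeas (Info Z A n × ProbabilityMeasure X)] {ip | c n ip} := by
    intro n
    have h1 : UniversallyMeasurableSet
        {x : (ProbabilityMeasure (TrajO X Z A) × Info Z A n) × A | x.2 ∈ U n x.1.2} :=
      (Measurable.universallyMeasurable (f := fun x :
        (ProbabilityMeasure (TrajO X Z A) × Info Z A n) × A => (x.1.2, x.2))
        (by fun_prop)).preimage (universallyMeasurableSet_of_analyticSet (hΓ n))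
    have h2 := universallyMeasurable_kernel_section (actionKernel F n) h1 {1}
      (measurableSet_singleton 1)
    have h3 := hg n _ (measurable_actionProb F n hD)
    exact @MeasurableSet.inter _ (univMeas _) _ _ ((hg n).preimage h2) h3
  let m : ∀ n, Info Z A n × ProbabilityMeasure X → Measure A := fun n ip =>
    if c n ip then actionKernel F n (g n ip) else Measure.dirac (φ n ip.1)
  have hmt : ∀ n ip, c n ip → m n ip = actionKernel F n (g n ip) := fun n ip h => if_pos h
  have hmf : ∀ n ip, ¬ c n ip → m n ip = Measure.dirac (φ n ip.1) := fun n ip h => if_neg h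
  have hprob : ∀ n ip, IsProbabilityMeasure (m n ip) := by
    intro n ip
    by_cases h : c n ip
    · rw [hmt n ip h]; infer_instance
    · rw [hmf n ip h]; infer_instance
  let π : PolicyI X U :=
    { μ := m
      isProb := hprob
      umeas := by
        intro n B hB t ht
        have h1 : @Measurable _ _ (univMeas (Info Z A n × ProbabilityMeasure X)) _
            fun ip => actionKernel F n (g n ip) B :=
          fun s hs => hg n _ (Kernel.measurable_coe (actionKernel F n) hB hs)
        have h2 : @Measurable _ _ (univMeas (Info Z A n × ProbabilityMeasure X)) _
            fun ip => Measure.dirac (φ n ip.1) B := fun s hs =>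
          (Measurable.universallyMeasurable measurable_fst).preimage
            (hφ n _ ((Measure.measurable_coe hB).comp Measure.measurable_dirac hs))
        have h3 : @Measurable _ _ (univMeas (Info Z A n × ProbabilityMeasure X)) _ fun ip =>
            if c n ip then actionKernel F n (g n ip) B else Measure.dirac (φ n ip.1) B :=
          Measurable.ite (hc n) h1 h2
        have h4 : (fun ip => m n ip B) = fun ip =>
            if c n ip then actionKernel F n (g n ip) B else Measure.dirac (φ n ip.1) B := by
          funext ip
          by_cases h : c n ip
          · rw [hmt n ip h, if_pos h]
          · rw [hmf n ip h, if_neg h]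
        rw [h4]
        exact h3 ht
      feasible := by
        intro n i p0
        by_cases h : c n (i, p0)
        · rw [hmt n _ h]
          exact h.1
        · rw [hmf n _ h]
          exact Measure.dirac_apply_of_mem (hφU n i) }
  refine ⟨π, fun n ip => ?_, fun p0 hp h0 => ?_⟩
  · by_cases h : c n ip
    · have heq : (⟨m n ip, hprob n ip⟩ : ProbabilityMeasure A) = actionProb F n (g n ip) :=
        Subtype.ext (hmt n ip h)
      exact heq ▸ h.2
    · have heq : (⟨m n ip, hprob n ip⟩ : ProbabilityMeasure A) = diracProba (φ n ip.1) :=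
        Subtype.ext (hmf n ip h)
      exact heq ▸ hdirac (φ n ip.1)
  · refine inducesI_of_stepMeasure hF π p0 _ ?_ (fun n => (actionKernel F n).sectR (ζ p0))
      (fun n => ?_) fun n => (hp n).1
    · rw [← h0, Measure.map_map (by fun_prop) (by fun_prop)]
      congr 1
      funext ω
      exact Prod.ext (Subsingleton.elim _ _) rfl
    · have : IsProbabilityMeasure (((ζ p0).toMeasure.map (histMap n)).map (infoOf F)) :=
        Measure.isProbabilityMeasure_map (measurable_infoOf hF).aemeasurable
      have h1 := (hp n).2.1
      rw [jointKernel_apply_eq_compProd hF, compProd_eq_one_iff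
        (universallyMeasurableSet_of_analyticSet (hΓ n) _ inferInstance)] at h1
      filter_upwards [h1, (hp n).2.2] with i hi hi'
      exact hmt n (i, p0) ⟨hi, hi'⟩

theorem setOf_isConsistent_eq (hF : Measurable F) (hne : ∀ n i, (U n i).Nonempty)
    (hΓ : ∀ n : ℕ, AnalyticSet {ia : Info Z A n × A | ia.2 ∈ U n ia.1})
    (hD : MeasurableSet D) (hdirac : ∀ a : A, diracProba a ∈ D) :
    SIOf q F U (ActsIn D) = {p | IsConsistent q hF U D p} := by
  ext p
  constructor
  · rintro ⟨π, p0, hπ, h⟩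
    exact isConsistent_of_inducesI hF hΓ hπ h
  · intro h
    obtain ⟨π, hπ, hind⟩ := exists_policy (q := q) hF hne hΓ hD hdirac (ζ := fun _ => p)
      (Measurable.universallyMeasurable measurable_const)
    exact ⟨π, p.map (f := fun ω => (ω 0).1)
      (measurable_fst.comp (measurable_pi_apply 0)).aemeasurable, hπ, hind _ h rfl⟩

lemma measurableSet_step (hF : Measurable F) (n : ℕ) :
    MeasurableSet {p : ProbabilityMeasure (TrajO X Z A) | p.toMeasure.map (histMap (n + 1))
      = stepMeasure q hF (p.toMeasure.map (histMap n)) ((actionKernel F n).sectR p)} := by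
  let f : ProbabilityMeasure (TrajO X Z A) → ProbabilityMeasure (HistO X Z A (n + 1)) := fun p =>
    ⟨p.toMeasure.map (histMap (n + 1)), inferInstance⟩
  let f' : ProbabilityMeasure (TrajO X Z A) → ProbabilityMeasure (HistO X Z A (n + 1)) := fun p =>
    ⟨stepMeasure q hF (p.toMeasure.map (histMap n)) ((actionKernel F n).sectR p), inferInstance⟩
  have hf : Measurable f := measurable_probabilityMeasure_of_apply fun B hB => by
    have := Kernel.measurable_coe ((evalKernel (TrajO X Z A)).map (histMap (n + 1))) hB
    simp_rw [Kernel.map_apply _ measurable_histMap] at this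
    exact this
  have hf' : Measurable f' := measurable_probabilityMeasure_of_apply fun B hB => by
    have := Kernel.measurable_coe (stepHistKernel q hF n) hB
    simp_rw [stepHistKernel_apply] at this
    exact this
  convert! measurableSet_eq_fun hf hf' using 1
  ext p
  exact (Subtype.ext_iff (a1 := f p) (a2 := f' p)).symm

lemma measurableSet_ae_actionProb_mem (hF : Measurable F) (hD : MeasurableSet D) (n : ℕ) :
    MeasurableSet {p : ProbabilityMeasure (TrajO X Z A) |
      ∀ᵐ i ∂(p.toMeasure.map (histMap n)).map (infoOf F), actionProb F n (p, i) ∈ D} := by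
  have h := Kernel.measurable_kernel_prodMk_left (κ := ((jointKernel (A := A) F n).map Prod.fst))
    (measurable_actionProb F n hD.compl)
  convert! h (measurableSet_singleton 0) using 1
  ext p
  simp only [Set.mem_preimage, Set.mem_singleton_iff, Kernel.map_apply _ measurable_fst,
    map_fst_jointKernel hF]
  rfl

lemma setOf_isConsistent_eq_iInter (hF : Measurable F) :
    {p : ProbabilityMeasure (TrajO X Z A) | IsConsistent q hF U D p} =
      ⋂ n, {p | p.toMeasure.map (histMap (n + 1))
        = stepMeasure q hF (p.toMeasure.map (histMap n)) ((actionKernel F n).sectR p)} ∩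
      ({p | jointKernel F n p {ia | ia.2 ∈ U n ia.1} = 1} ∩
      {p | ∀ᵐ i ∂(p.toMeasure.map (histMap n)).map (infoOf F), actionProb F n (p, i) ∈ D}) := by
  ext p
  simp only [IsConsistent, Set.mem_iInter]
  rfl

theorem analyticSet_isConsistent (hF : Measurable F)
    (hΓ : ∀ n : ℕ, AnalyticSet {ia : Info Z A n × A | ia.2 ∈ U n ia.1})
    (hD : MeasurableSet D) :
    AnalyticSet {p : ProbabilityMeasure (TrajO X Z A) | IsConsistent q hF U D p} := by
  rw [setOf_isConsistent_eq_iInter]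
  refine AnalyticSet.iInter fun n => ?_
  refine analyticSet_inter (analyticSet_of_measurableSet (measurableSet_step hF n))
    (analyticSet_inter ?_ (analyticSet_of_measurableSet (measurableSet_ae_actionProb_mem hF hD n)))
  let f : ProbabilityMeasure (TrajO X Z A) → ProbabilityMeasure (Info Z A n × A) := fun p =>
    p.map (f := fun ω => infoAction F (histMap (n + 1) ω))
      ((measurable_infoAction hF).comp measurable_histMap).aemeasurable
  have hf : ∀ p, (f p).toMeasure = jointKernel F n p := fun p => by
    rw [jointKernel_apply hF, Measure.map_map (measurable_infoAction hF) measurable_histMap]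
    rfl
  have hfm : Measurable f := measurable_probabilityMeasure_of_apply fun B hB => by
    simp_rw [hf]
    exact Kernel.measurable_coe _ hB
  convert! analyticSet_preimage_of_measurable hfm (analyticSet_measure_eq_one (hΓ n)) using 1
  simp_rw [Set.preimage_ofPred_eq, hf]

theorem measurableSet_isConsistent (hF : Measurable F)
    (hΓ : ∀ n : ℕ, MeasurableSet {ia : Info Z A n × A | ia.2 ∈ U n ia.1})
    (hD : MeasurableSet D) :
    MeasurableSet {p : ProbabilityMeasure (TrajO X Z A) | IsConsistent q hF U D p} := by
  rw [setOf_isConsistent_eq_iInter]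
  refine MeasurableSet.iInter fun n => ?_
  refine (measurableSet_step hF n).inter (MeasurableSet.inter ?_
    (measurableSet_ae_actionProb_mem hF hD n))
  exact Kernel.measurable_coe _ (hΓ n) (measurableSet_singleton 1)

end Disintegration

section Main

lemma isEmpty_probabilityMeasure (Y : Type*) [MeasurableSpace Y] [IsEmpty Y] :
    IsEmpty (ProbabilityMeasure Y) := ⟨fun p => by
  have h := p.2.measure_univ
  rw [Set.univ_eq_empty_iff.2 inferInstance, measure_empty] at h
  exact zero_ne_one h⟩

variable {X Z A : Type*} [TopologicalSpace X] [PolishSpace X] [MeasurableSpace X] [BorelSpace X]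
  [TopologicalSpace Z] [PolishSpace Z] [MeasurableSpace Z] [BorelSpace Z]
  [TopologicalSpace A] [PolishSpace A] [MeasurableSpace A] [BorelSpace A]

/-- The distribution of the initial state. -/
def initialMarginal (p : ProbabilityMeasure (TrajO X Z A)) : ProbabilityMeasure X :=
  p.map (f := fun ω => (ω 0).1) (measurable_fst.comp (measurable_pi_apply 0)).aemeasurable

lemma continuous_initialMarginal :
    Continuous (initialMarginal : ProbabilityMeasure (TrajO X Z A) → ProbabilityMeasure X) :=
  ProbabilityMeasure.continuous_map (continuous_fst.comp (continuous_apply 0))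

variable {q : Kernel (X × A) X} {F : X → Z} {U : ∀ n : ℕ, Info Z A n → Set A}
  {C : PolicyI X U → Prop}

lemma mem_tsetI_iff {pp : ProbabilityMeasure X × ProbabilityMeasure (TrajO X Z A)} :
    pp ∈ tsetI q F U C ↔ pp.2 ∈ SIOf q F U C ∧ initialMarginal pp.2 = pp.1 :=
  and_congr_right fun _ => (Subtype.ext_iff (a1 := initialMarginal pp.2) (a2 := pp.1)).symm

lemma analyticSet_tsetI (h : AnalyticSet (SIOf q F U C)) : AnalyticSet (tsetI q F U C) := by
  convert! h.image_of_continuous (continuous_initialMarginal.prodMk continuous_id) using 1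
  ext pp
  rw [mem_tsetI_iff]
  constructor
  · exact fun hp => ⟨pp.2, hp.1, Prod.ext hp.2 rfl⟩
  · rintro ⟨p, hp, rfl⟩
    exact ⟨hp, rfl⟩

lemma measurableSet_tsetI (h : MeasurableSet (SIOf q F U C)) :
    MeasurableSet (tsetI q F U C) := by
  have h' : tsetI q F U C = Prod.snd ⁻¹' SIOf q F U C ∩ {pp | initialMarginal pp.2 = pp.1} := by
    ext pp
    exact mem_tsetI_iff
  rw [h']
  exact (measurable_snd h).inter (measurableSet_eq_fun
    (continuous_initialMarginal.measurable.comp measurable_snd) measurable_fst)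

lemma actsIn_univ [Nonempty A] : ActsIn (U := U) (X := X) Set.univ = fun _ => True := by
  funext π
  exact propext ⟨fun _ => trivial, fun _ _ _ => Set.mem_univ _⟩

lemma actsIn_range_diracProba [Nonempty A] :
    ActsIn (U := U) (X := X) (Set.range diracProba) = PolicyI.Nonrandomized := by
  funext π
  refine propext (forall_congr' fun n => forall_congr' fun ip => exists_congr fun a => ?_)
  exact ⟨fun h => congrArg ProbabilityMeasure.toMeasure h.symm, fun h => Subtype.ext h.symm⟩

lemma measurableSet_range_diracProba :
    MeasurableSet (Set.range (diracProba : A → ProbabilityMeasure A)) := by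
  rw [← Set.image_univ]
  exact MeasurableSet.univ.image_of_measurable_injOn continuous_diracProba.measurable
    injective_diracProba.injOn

variable [IsMarkovKernel q]

lemma exists_policy_of_mem_tsecI [Nonempty A] (hF : Measurable F)
    (hne : ∀ n i, (U n i).Nonempty)
    (hΓ : ∀ n : ℕ, AnalyticSet {ia : Info Z A n × A | ia.2 ∈ U n ia.1})
    {D : Set (ProbabilityMeasure A)} (hD : MeasurableSet D) (hdirac : ∀ a : A, diracProba a ∈ D)
    {ζ : ProbabilityMeasure X → ProbabilityMeasure (TrajO X Z A)} (hζ : UniversallyMeasurable ζ)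
    (hmem : ∀ p0, ζ p0 ∈ tsecI q F U (ActsIn D) p0) :
    ∃ π : PolicyI X U, ActsIn D π ∧ ∀ p0, InducesI q F π p0 (ζ p0).toMeasure := by
  obtain ⟨π, hπ, h⟩ := exists_policy (q := q) hF hne hΓ hD hdirac hζ
  refine ⟨π, hπ, fun p0 => h p0 ?_ (hmem p0).2⟩
  have := (hmem p0).1
  rwa [setOf_isConsistent_eq hF hne hΓ hD hdirac] at this

/-- The policy on an empty domain. -/
def emptyPolicy [IsEmpty (ProbabilityMeasure X)] (U : ∀ n : ℕ, Info Z A n → Set A) :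
    PolicyI X U where
  μ _ ip := isEmptyElim ip.2
  isProb _ ip := isEmptyElim ip.2
  umeas _ _ _ _ _ := by
    rw [Set.eq_empty_of_isEmpty (_ ⁻¹' _)]
    exact fun _ _ => nullMeasurableSet_empty
  feasible _ _ p0 := isEmptyElim p0

end Main

/-- Proposition `prp-Si-pol`: for the partially observable model,
(i) the sets `S_I`, `S'_I`, `tilde-S_I`, `tilde-S'_I` are analytic, and Borel if all the
constraint graphs `Γ_n` are Borel; (ii) every universally measurable selection
`ζ : P(𝕏) → P(Ω)` of `tilde-S_I` (resp. `tilde-S'_I`) is realized by a policy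
(resp. a nonrandomized policy). -/
theorem statement13
    {X Z A : Type*} [TopologicalSpace X] [PolishSpace X] [MeasurableSpace X] [BorelSpace X]
    [TopologicalSpace Z] [PolishSpace Z] [MeasurableSpace Z] [BorelSpace Z]
    [TopologicalSpace A] [PolishSpace A] [MeasurableSpace A] [BorelSpace A]
    (q : Kernel (X × A) X) [IsMarkovKernel q]
    (F : X → Z) (hF : Measurable F)
    (U : ∀ n : ℕ, Info Z A n → Set A)
    (hne : ∀ n i, (U n i).Nonempty)
    (hΓ : ∀ n : ℕ, MeasureTheory.AnalyticSet {ia : Info Z A n × A | ia.2 ∈ U n ia.1}) :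
    -- (i)
    ((MeasureTheory.AnalyticSet (SIOf q F U fun _ => True) ∧
      MeasureTheory.AnalyticSet (SIOf q F U PolicyI.Nonrandomized) ∧
      MeasureTheory.AnalyticSet (tsetI q F U fun _ => True) ∧
      MeasureTheory.AnalyticSet (tsetI q F U PolicyI.Nonrandomized)) ∧
     ((∀ n : ℕ, MeasurableSet {ia : Info Z A n × A | ia.2 ∈ U n ia.1}) →
      MeasurableSet (SIOf q F U fun _ => True) ∧
      MeasurableSet (SIOf q F U PolicyI.Nonrandomized) ∧
      MeasurableSet (tsetI q F U fun _ => True) ∧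
      MeasurableSet (tsetI q F U PolicyI.Nonrandomized))) ∧
    -- (ii)
    ((∀ ζ : ProbabilityMeasure X → ProbabilityMeasure (TrajO X Z A),
        UniversallyMeasurable ζ →
        (∀ p0, ζ p0 ∈ tsecI q F U (fun _ => True) p0) →
        ∃ π : PolicyI X U, ∀ p0, InducesI q F π p0 (ζ p0).toMeasure) ∧
     (∀ ζ : ProbabilityMeasure X → ProbabilityMeasure (TrajO X Z A),
        UniversallyMeasurable ζ →
        (∀ p0, ζ p0 ∈ tsecI q F U PolicyI.Nonrandomized p0) →
        ∃ π : PolicyI X U, π.Nonrandomized ∧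
          ∀ p0, InducesI q F π p0 (ζ p0).toMeasure)) := by
  rcases isEmpty_or_nonempty A with hA | hA
  · have hΩ : IsEmpty (TrajO X Z A) := ⟨fun ω => hA.elim (ω 0).2.2⟩
    have hP := isEmpty_probabilityMeasure (TrajO X Z A)
    have h1 : ∀ C, SIOf q F U C = ∅ := fun _ => Set.eq_empty_of_isEmpty _
    have h2 : ∀ C, tsetI q F U C = ∅ := fun _ => Set.eq_empty_of_isEmpty _
    simp only [h1, h2]
    refine ⟨⟨⟨analyticSet_empty, analyticSet_empty, analyticSet_empty, analyticSet_empty⟩,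
      fun _ => ⟨.empty, .empty, .empty, .empty⟩⟩, fun ζ _ _ => ?_, fun ζ _ _ => ?_⟩
    · have := Function.isEmpty ζ
      exact ⟨emptyPolicy U, fun p0 => isEmptyElim p0⟩
    · have := Function.isEmpty ζ
      exact ⟨emptyPolicy U, fun n ip => isEmptyElim ip.2, fun p0 => isEmptyElim p0⟩
  have hd : ∀ a : A, diracProba a ∈ Set.range (diracProba : A → ProbabilityMeasure A) :=
    fun a => ⟨a, rfl⟩
  have hDm := measurableSet_range_diracProba (A := A)
  have hu : ∀ a : A, diracProba a ∈ (Set.univ : Set (ProbabilityMeasure A)) :=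
    fun _ => Set.mem_univ _
  have hum : MeasurableSet (Set.univ : Set (ProbabilityMeasure A)) := MeasurableSet.univ
  rw [← actsIn_univ, ← actsIn_range_diracProba]
  have ha : ∀ D : Set (ProbabilityMeasure A), MeasurableSet D → (∀ a, diracProba a ∈ D) →
      AnalyticSet (SIOf q F U (ActsIn D)) := fun D h h' => by
    rw [setOf_isConsistent_eq hF hne hΓ h h']
    exact analyticSet_isConsistent hF hΓ h
  refine ⟨⟨⟨ha _ hum hu, ha _ hDm hd, analyticSet_tsetI (ha _ hum hu),
    analyticSet_tsetI (ha _ hDm hd)⟩, fun hB => ?_⟩, fun ζ hζ hmem => ?_, fun ζ hζ hmem => ?_⟩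
  · have hb : ∀ D : Set (ProbabilityMeasure A), MeasurableSet D → (∀ a, diracProba a ∈ D) →
        MeasurableSet (SIOf q F U (ActsIn D)) := fun D h h' => by
      rw [setOf_isConsistent_eq hF hne hΓ h h']
      exact measurableSet_isConsistent hF hB h
    exact ⟨hb _ hum hu, hb _ hDm hd, measurableSet_tsetI (hb _ hum hu),
      measurableSet_tsetI (hb _ hDm hd)⟩
  · obtain ⟨π, -, h⟩ := exists_policy_of_mem_tsecI hF hne hΓ hum hu hζ hmem
    exact ⟨π, h⟩
  · obtain ⟨π, hπ, h⟩ := exists_policy_of_mem_tsecI hF hne hΓ hDm hd hζ hmem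
    exact ⟨π, hπ, h⟩

end PaperStmt
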